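/- Let φ : R → S be a surjective ring homomorphism with kernel I, and let N be an S-module. Then Tor_1^R(S, N) is naturally isomorphic as an S-module to (I/I²) ⊗_S N; in particular Tor_1^R(S, S) ≅ I/I². -/

import Mathlib

open CategoryTheory TensorProduct

universe u

section

variable {R : Type*} [CommRing R] (I : Ideal R)

namespace Ideal

/-- The multiplication map `I ⊗ P → P`. -/
noncomputable def tensorMul (P : Type*) [AddCommGroup P] [Module R P] : I ⊗[R] P →ₗ[R] P :=
  (TensorProduct.lid R P).toLinearMap ∘ₗ LinearMap.rTensor P I.subtype

section

variable {P Q : Type*} [AddCommGroup P] [Module R P] [AddCommGroup Q] [Module R Q]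

@[simp]
lemma tensorMul_tmul (i : I) (p : P) : I.tensorMul P (i ⊗ₜ p) = (i : R) • p := by
  simp [tensorMul]

lemma tensorMul_lTensor (f : P →ₗ[R] Q) (t : I ⊗[R] P) :
    I.tensorMul Q (LinearMap.lTensor I f t) = f (I.tensorMul P t) := by
  induction t with
  | zero => simp
  | tmul i p => simp
  | add s t hs ht => simp [hs, ht]

lemma tensorMul_injective [Module.Flat R P] : Function.Injective (I.tensorMul P) :=
  (TensorProduct.lid R P).injective.comp
    (Module.Flat.rTensor_preserves_injective_linearMap I.subtype I.injective_subtype)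

lemma tmul_eq_zero_iff_mem_range_tensorMul {S : Type*} [AddCommGroup S] [Module R S]
    {π : R →ₗ[R] S} (hπ : Function.Surjective π) (hI : Function.Exact I.subtype π) (p : P) :
    π 1 ⊗ₜ[R] p = 0 ↔ p ∈ LinearMap.range (I.tensorMul P) := by
  have h := rTensor_exact P hI hπ ((1 : R) ⊗ₜ p)
  rw [LinearMap.rTensor_tmul] at h
  refine h.trans ⟨?_, ?_⟩
  · rintro ⟨t, ht⟩
    exact ⟨t, by simp [tensorMul, ht]⟩
  · rintro ⟨t, ht⟩
    exact ⟨t, (TensorProduct.lid R P).injective (by simpa [tensorMul] using ht)⟩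

end

end Ideal

lemma TensorProduct.mk_map_one_surjective {S P : Type*} [AddCommGroup S] [Module R S]
    [AddCommGroup P] [Module R P] {π : R →ₗ[R] S} (hπ : Function.Surjective π) :
    Function.Surjective (TensorProduct.mk R S P (π 1)) := by
  intro z
  obtain ⟨t, rfl⟩ := LinearMap.rTensor_surjective P hπ z
  refine ⟨TensorProduct.lid R P t, ?_⟩
  induction t with
  | zero => simp
  | tmul r p =>
    rw [TensorProduct.lid_tmul, TensorProduct.mk_apply, ← TensorProduct.smul_tmul, ← map_smul,
      smul_eq_mul, mul_one, LinearMap.rTensor_tmul]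
  | add s t hs ht => rw [map_add, map_add, map_add, hs, ht]

/-- Given a surjection `q : P → X₂`, the homology of `X₁ → X₂ → X₃` at `X₂` is the target of any
surjection from `ker (g ∘ q)` whose kernel consists of the elements mapped by `q` to boundaries. -/
lemma nonempty_homology_linearEquiv_of_surjective {X₁ X₂ X₃ P W : Type*}
    [AddCommGroup X₁] [Module R X₁] [AddCommGroup X₂] [Module R X₂] [AddCommGroup X₃] [Module R X₃]
    [AddCommGroup P] [Module R P] [AddCommGroup W] [Module R W]
    (f : X₁ →ₗ[R] X₂) (g : X₂ →ₗ[R] X₃) (hgf : ∀ x, f x ∈ LinearMap.ker g)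
    (q : P →ₗ[R] X₂) (hq : Function.Surjective q)
    (φ : LinearMap.ker (g ∘ₗ q) →ₗ[R] W) (hφ : Function.Surjective φ)
    (hφ_zero : ∀ x, φ x = 0 ↔ q x ∈ LinearMap.range f) :
    Nonempty ((LinearMap.ker g ⧸ LinearMap.range (f.codRestrict _ hgf)) ≃ₗ[R] W) := by
  let ψ : LinearMap.ker (g ∘ₗ q) →ₗ[R] LinearMap.ker g ⧸ LinearMap.range (f.codRestrict _ hgf) :=
    Submodule.mkQ _ ∘ₗ (q ∘ₗ Submodule.subtype _).codRestrict (LinearMap.ker g) fun x ↦ x.2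
  have hψ : Function.Surjective ψ := by
    refine (Submodule.mkQ_surjective _).comp ?_
    rintro ⟨y, hy⟩
    obtain ⟨x, rfl⟩ := hq y
    exact ⟨⟨x, hy⟩, rfl⟩
  have hker : LinearMap.ker ψ = LinearMap.ker φ := by
    ext x
    rw [LinearMap.mem_ker, LinearMap.mem_ker, hφ_zero]
    simp only [ψ, LinearMap.comp_apply, Submodule.mkQ_apply, Submodule.Quotient.mk_eq_zero,
      LinearMap.mem_range]
    exact exists_congr fun y ↦ Subtype.ext_iff
  exact ⟨(ψ.quotKerEquivOfSurjective hψ).symm ≪≫ₗ Submodule.quotEquivOfEq _ _ hker ≪≫ₗ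
    φ.quotKerEquivOfSurjective hφ⟩

/-- If `P₂ → P₁ → P₀ → N → 0` is exact with `P₀` flat, `I` kills `N` and `S` is `R ⧸ I`,
then the homology of `S ⊗ P₂ → S ⊗ P₁ → S ⊗ P₀` is `I ⊗ N`. -/
lemma Ideal.nonempty_homology_lTensor_quotient_linearEquiv {S P₂ P₁ P₀ N : Type*}
    [AddCommGroup S] [Module R S]
    [AddCommGroup P₂] [Module R P₂] [AddCommGroup P₁] [Module R P₁] [AddCommGroup P₀] [Module R P₀]
    [AddCommGroup N] [Module R N] [Module.Flat R P₀]
    {π : R →ₗ[R] S} (hπ : Function.Surjective π) (hI : Function.Exact I.subtype π)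
    (d₂ : P₂ →ₗ[R] P₁) (d₁ : P₁ →ₗ[R] P₀) (ε : P₀ →ₗ[R] N) (exact₁ : Function.Exact d₂ d₁)
    (exact₀ : Function.Exact d₁ ε) (hε : Function.Surjective ε) (hN : ∀ i ∈ I, ∀ n : N, i • n = 0)
    (h : ∀ x, LinearMap.lTensor S d₂ x ∈ LinearMap.ker (LinearMap.lTensor S d₁)) :
    Nonempty ((LinearMap.ker (LinearMap.lTensor S d₁) ⧸
      LinearMap.range ((LinearMap.lTensor S d₂).codRestrict _ h)) ≃ₗ[R] I ⊗[R] N) := by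
  let e := LinearEquiv.ofInjective (I.tensorMul P₀) I.tensorMul_injective
  let q := TensorProduct.mk R S P₁ (π 1)
  let A := LinearMap.ker (LinearMap.lTensor S d₁ ∘ₗ q)
  let δ : A →ₗ[R] LinearMap.range (I.tensorMul P₀) :=
    (d₁ ∘ₗ A.subtype).codRestrict _ fun x ↦
      (I.tmul_eq_zero_iff_mem_range_tensorMul hπ hI (d₁ x)).1 (LinearMap.mem_ker.1 x.2)
  have tensorMul_symm (x) : I.tensorMul P₀ (e.symm (δ x)) = d₁ x :=
    congrArg Subtype.val (e.apply_symm_apply (δ x))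
  have exact : Function.Exact (LinearMap.lTensor I d₁) (LinearMap.lTensor I ε) :=
    lTensor_exact I exact₀ hε
  refine nonempty_homology_linearEquiv_of_surjective _ _ h q
    (TensorProduct.mk_map_one_surjective hπ)
    (LinearMap.lTensor I ε ∘ₗ e.symm.toLinearMap ∘ₗ δ) ?_ ?_
  · intro w
    obtain ⟨t, rfl⟩ := LinearMap.lTensor_surjective I hε w
    have ht : ε (I.tensorMul P₀ t) = 0 := by
      rw [← tensorMul_lTensor]
      induction LinearMap.lTensor I ε t with
      | zero => simp
      | tmul i n => simp [hN i i.2]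
      | add s t hs ht => simp [hs, ht]
    obtain ⟨x, hx⟩ := (exact₀ _).1 ht
    have hx' : x ∈ LinearMap.ker (LinearMap.lTensor S d₁ ∘ₗ q) := by
      simpa [q] using (I.tmul_eq_zero_iff_mem_range_tensorMul hπ hI (d₁ x)).2 ⟨t, hx.symm⟩
    refine ⟨⟨x, hx'⟩, congrArg (LinearMap.lTensor I ε) (I.tensorMul_injective ?_)⟩
    exact (tensorMul_symm ⟨x, hx'⟩).trans hx
  · intro x
    refine (exact _).trans ⟨?_, ?_⟩
    · rintro ⟨s, hs⟩
      have hd : d₁ (x - I.tensorMul P₁ s) = 0 := by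
        rw [map_sub, ← tensorMul_lTensor, hs, sub_eq_zero]
        exact (tensorMul_symm x).symm
      obtain ⟨y, hy⟩ := (exact₁ _).1 hd
      refine ⟨π 1 ⊗ₜ y, ?_⟩
      have hs₀ : π 1 ⊗ₜ[R] I.tensorMul P₁ s = 0 :=
        (I.tmul_eq_zero_iff_mem_range_tensorMul hπ hI _).2 ⟨s, rfl⟩
      simp [q, hy, TensorProduct.tmul_sub, hs₀]
    · rintro ⟨z, hz⟩
      obtain ⟨y, rfl⟩ := TensorProduct.mk_map_one_surjective hπ z
      have hxy : π 1 ⊗ₜ[R] ((x : P₁) - d₂ y) = 0 := by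
        rw [TensorProduct.tmul_sub, sub_eq_zero]
        exact hz.symm
      obtain ⟨s, hs⟩ := (I.tmul_eq_zero_iff_mem_range_tensorMul hπ hI _).1 hxy
      refine ⟨s, I.tensorMul_injective ?_⟩
      rw [tensorMul_lTensor, hs, map_sub, exact₁.apply_apply_eq_zero, sub_zero]
      exact (tensorMul_symm x).symm

/-- The cotangent module `I / I²` is `R ⧸ I ⊗ I`. -/
lemma Ideal.nonempty_cotangent_linearEquiv :
    Nonempty (I.Cotangent ≃ₗ[R ⧸ I] (R ⧸ I) ⊗[R] I) :=
  let e : I.Cotangent ≃ₗ[R] (R ⧸ I) ⊗[R] I := (TensorProduct.quotTensorEquivQuotSMul I I).symm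
  ⟨e.extendScalarsOfSurjective Ideal.Quotient.mk_surjective⟩

lemma Ideal.nonempty_cotangent_tensor_linearEquiv (N : Type*) [AddCommGroup N] [Module (R ⧸ I) N]
    [Module R N] [IsScalarTower R (R ⧸ I) N] :
    Nonempty (I.Cotangent ⊗[R ⧸ I] N ≃ₗ[R] I ⊗[R] N) := by
  obtain ⟨e⟩ := I.nonempty_cotangent_linearEquiv
  let e₁ : I.Cotangent ⊗[R ⧸ I] N ≃ₗ[R ⧸ I] N ⊗[R] I :=
    TensorProduct.congr e (LinearEquiv.refl _ _) ≪≫ₗ TensorProduct.comm _ _ _ ≪≫ₗ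
      TensorProduct.AlgebraTensorModule.cancelBaseChange R (R ⧸ I) (R ⧸ I) N I
  exact ⟨e₁.restrictScalars R ≪≫ₗ TensorProduct.comm R N I⟩

end

/-- If `I` kills `N`, then `Tor₁(R ⧸ I, N)` is `I ⊗ N`. -/
lemma Ideal.nonempty_tor_one_iso_tensor {R : Type u} [CommRing R] (I : Ideal R) (N : Type u)
    [AddCommGroup N] [Module R N] (hN : ∀ i ∈ I, ∀ n : N, i • n = 0) :
    Nonempty ((((Tor (ModuleCat.{u} R) 1).obj (ModuleCat.of R (R ⧸ I))).obj
      (ModuleCat.of R N)) ≅ ModuleCat.of R (I ⊗[R] N)) := by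
  let P := ProjectiveResolution.of (ModuleCat.of R N)
  let F := (MonoidalCategory.tensoringLeft (ModuleCat.{u} R)).obj (ModuleCat.of R (R ⧸ I))
  let K := (F.mapHomologicalComplex (ComplexShape.down ℕ)).obj P.complex
  have e : (((Tor (ModuleCat.{u} R) 1).obj (ModuleCat.of R (R ⧸ I))).obj (ModuleCat.of R N)) ≅
      (K.sc' 2 1 0).homology :=
    P.isoLeftDerivedObj F 1 ≪≫
      ShortComplex.homologyMapIso (K.isoSc' 2 1 0 (by simp) (by simp))
  have exact₁ : Function.Exact (P.complex.d 2 1).hom (P.complex.d 1 0).hom :=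
    (ShortComplex.ShortExact.moduleCat_exact_iff_function_exact _).1 (P.exact_succ 0)
  have exact₀ : Function.Exact (P.complex.d 1 0).hom (P.π.f 0).hom :=
    (ShortComplex.ShortExact.moduleCat_exact_iff_function_exact _).1 P.exact₀
  have hε : Function.Surjective (P.π.f 0).hom :=
    (ModuleCat.epi_iff_surjective _).1 inferInstance
  have : Module.Projective R (P.complex.X 0) := inferInstance
  obtain ⟨e'⟩ := I.nonempty_homology_lTensor_quotient_linearEquiv
    I.mkQ_surjective (LinearMap.exact_subtype_mkQ I) _ _ _ exact₁ exact₀ hε hN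
    (K.sc' 2 1 0).moduleCat_zero_apply
  exact ⟨e ≪≫ (K.sc' 2 1 0).moduleCatHomologyIso ≪≫ e'.toModuleIso⟩

/-- For a surjective ring homomorphism `R → S = R/I` with kernel `I`, and an `S`-module `N`,
`Tor₁^R(S, N)` is naturally isomorphic to `(I/I²) ⊗[S] N`; in particular
`Tor₁^R(S, S) ≅ I/I²`. -/
theorem tor_one_of_quotient (R : Type u) [CommRing R] (I : Ideal R)
    (N : Type u) [AddCommGroup N] [Module (R ⧸ I) N] [Module R N]
    [IsScalarTower R (R ⧸ I) N] :
    Nonempty ((((Tor (ModuleCat.{u} R) 1).obj (ModuleCat.of R (R ⧸ I))).obj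
        (ModuleCat.of R N)) ≅
      ModuleCat.of R (I.Cotangent ⊗[R ⧸ I] N)) ∧
    Nonempty ((((Tor (ModuleCat.{u} R) 1).obj (ModuleCat.of R (R ⧸ I))).obj
        (ModuleCat.of R (R ⧸ I))) ≅
      ModuleCat.of R I.Cotangent) := by
  have key (M : Type u) [AddCommGroup M] [Module (R ⧸ I) M] [Module R M]
      [IsScalarTower R (R ⧸ I) M] :
      Nonempty ((((Tor (ModuleCat.{u} R) 1).obj (ModuleCat.of R (R ⧸ I))).obj
        (ModuleCat.of R M)) ≅ ModuleCat.of R (I.Cotangent ⊗[R ⧸ I] M)) := by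
    obtain ⟨e⟩ := I.nonempty_tor_one_iso_tensor M fun i hi m ↦ by
      rw [← algebraMap_smul (R ⧸ I) i m, Ideal.Quotient.algebraMap_eq,
        Ideal.Quotient.eq_zero_iff_mem.2 hi, zero_smul]
    obtain ⟨e'⟩ := I.nonempty_cotangent_tensor_linearEquiv M
    exact ⟨e ≪≫ e'.symm.toModuleIso⟩
  refine ⟨key N, ?_⟩
  obtain ⟨e⟩ := key (R ⧸ I)
  exact ⟨e ≪≫ ((TensorProduct.rid (R ⧸ I) I.Cotangent).restrictScalars R).toModuleIso⟩
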